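/- Let G = {T_{C_p k} g_p : p ∈ P, k ∈ ℤ^d} be a Bessel system satisfying the local boundedness condition, let D_p be invertible real d×d matrices for p ∈ P, and suppose H = {T_{D_p k} h_p : p ∈ P, k ∈ ℤ^d} is also Bessel and satisfies the local boundedness condition. Define Ω_{H,G} : L²(ℝ^d) → L²(ℝ^d), f ↦ Σ_{p∈P} Σ_{k∈ℤ^d} ⟨f, T_{C_p k} g_p⟩ T_{D_p k} h_p. Then for all f, g ∈ D, ⟨Ω_{H,G} f, g⟩ = Σ_{p∈P} |det(C_p) det(D_p)|^{-1} ∫_{[0,1]^d} [f̂, ĝ_p]_{C_p′}(C_p′ ξ) · [ĥ_p, ĝ]_{D_p′}(D_p′ ξ) dξ. -/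

import Mathlib

open MeasureTheory Complex Matrix
open scoped FourierTransform ENNReal NNReal RealInnerProductSpace Classical

noncomputable section

namespace GSL

/-- Euclidean space `ℝ^d`. -/
abbrev Rd (d : ℕ) := EuclideanSpace ℝ (Fin d)

/-- `L²(ℝ^d, ℂ)`. -/
abbrev L2 (d : ℕ) := Lp ℂ 2 (volume : Measure (Rd d))

/-- The point of `ℝ^d` corresponding to `z ∈ ℤ^d`. -/
def zv {d : ℕ} (z : Fin d → ℤ) : Rd d :=
  (EuclideanSpace.equiv (Fin d) ℝ).symm fun i => (z i : ℝ)

/-- Apply a real `d × d` matrix to a vector of `ℝ^d`. -/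
def mApp {d : ℕ} (A : Matrix (Fin d) (Fin d) ℝ) (x : Rd d) : Rd d :=
  (EuclideanSpace.equiv (Fin d) ℝ).symm (A.mulVec (EuclideanSpace.equiv (Fin d) ℝ x))

/-- `F` is the Fourier–Plancherel transform of `L²(ℝ^d)`: the (unique) isometric isomorphism
agreeing a.e. with the Fourier integral `𝓕 f (ξ) = ∫ f x e^{-2πi x·ξ} dx` on `L¹ ∩ L²`. -/
def IsFourier {d : ℕ} (F : L2 d ≃ₗᵢ[ℂ] L2 d) : Prop :=
  ∀ f : L2 d, Integrable (f : Rd d → ℂ) volume →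
    (F f : Rd d → ℂ) =ᵐ[volume] 𝓕 (f : Rd d → ℂ)

/-- A band: a measurable set of finite Lebesgue measure. -/
def IsBand {d : ℕ} (E : Set (Rd d)) : Prop := MeasurableSet E ∧ volume E < ⊤

/-- `V_E`: elements of `L²` whose Fourier transform vanishes a.e. outside `E`. -/
def Vband {d : ℕ} (F : L2 d ≃ₗᵢ[ℂ] L2 d) (E : Set (Rd d)) : Set (L2 d) :=
  {f | ∀ᵐ ξ ∂(volume : Measure (Rd d)), ξ ∉ E → (F f : Rd d → ℂ) ξ = 0}

/-- `f₀` is the continuous representative of `f ∈ L²`. -/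
def IsCRep {d : ℕ} (f : L2 d) (f₀ : Rd d → ℂ) : Prop :=
  Continuous f₀ ∧ (f : Rd d → ℂ) =ᵐ[volume] f₀

/-- The pairing `⟨f, T_y g⟩ = ∫ f(x) conj(g(x-y)) dx` (linear in the first variable). -/
def pair {d : ℕ} (f g : L2 d) (y : Rd d) : ℂ :=
  ∫ x, (f : Rd d → ℂ) x * (starRingEnd ℂ) ((g : Rd d → ℂ) (x - y))

/-- `‖Θ_A f‖²` for the samples `{A_j z + β_j}`, computed in `[0,∞]`. -/
def sampleSum {d n : ℕ} (A : Fin n → Matrix (Fin d) (Fin d) ℝ) (β : Fin n → Rd d)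
    (f₀ : Rd d → ℂ) : ℝ≥0∞ :=
  ∑' (j : Fin n) (z : Fin d → ℤ), (‖f₀ (mApp (A j) (zv z) + β j)‖₊ : ℝ≥0∞) ^ 2

/-- `‖Θ f‖²` for the single-lattice samples `{A z + β}`. -/
def sampleSum1 {d : ℕ} (A : Matrix (Fin d) (Fin d) ℝ) (β : Rd d) (f₀ : Rd d → ℂ) : ℝ≥0∞ :=
  ∑' z : Fin d → ℤ, (‖f₀ (mApp A (zv z) + β)‖₊ : ℝ≥0∞) ^ 2

/-- The sampling transform of `{A_j z + β_j}` is (well defined and) bounded on `V_E`. -/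
def ThetaBounded {d n : ℕ} (F : L2 d ≃ₗᵢ[ℂ] L2 d) (E : Set (Rd d))
    (A : Fin n → Matrix (Fin d) (Fin d) ℝ) (β : Fin n → Rd d) : Prop :=
  ∃ M : ℝ≥0∞, M < ⊤ ∧ ∀ f ∈ Vband F E, ∀ f₀, IsCRep f f₀ →
    sampleSum A β f₀ ≤ M * (‖f‖₊ : ℝ≥0∞) ^ 2

/-- The samples `{A_j z + β_j}` are tight on the band `E` with constant `K`. -/
def Tight {d n : ℕ} (F : L2 d ≃ₗᵢ[ℂ] L2 d) (E : Set (Rd d))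
    (A : Fin n → Matrix (Fin d) (Fin d) ℝ) (β : Fin n → Rd d) (K : ℝ≥0) : Prop :=
  ∀ f ∈ Vband F E, ∀ f₀, IsCRep f f₀ →
    sampleSum A β f₀ = (K : ℝ≥0∞) * (‖f‖₊ : ℝ≥0∞) ^ 2

/-- The single-lattice samples `{A z + β}` are tight on the band `E` with constant `K`. -/
def Tight1 {d : ℕ} (F : L2 d ≃ₗᵢ[ℂ] L2 d) (E : Set (Rd d))
    (A : Matrix (Fin d) (Fin d) ℝ) (β : Rd d) (K : ℝ≥0) : Prop :=
  ∀ f ∈ Vband F E, ∀ f₀, IsCRep f f₀ →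
    sampleSum1 A β f₀ = (K : ℝ≥0∞) * (‖f‖₊ : ℝ≥0∞) ^ 2

/-- Orthogonality of the samples `{A_j z + β_j}` and `{B_j z + γ_j}` on bands `E`, `F'`:
the ranges of the two sampling transforms are orthogonal in `⊕ⁿ ℓ²(ℤ^d)`. -/
def Orth {d n : ℕ} (F : L2 d ≃ₗᵢ[ℂ] L2 d) (E F' : Set (Rd d))
    (A : Fin n → Matrix (Fin d) (Fin d) ℝ) (β : Fin n → Rd d)
    (B : Fin n → Matrix (Fin d) (Fin d) ℝ) (γ : Fin n → Rd d) : Prop :=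
  ∀ f ∈ Vband F E, ∀ g ∈ Vband F F', ∀ f₀ g₀, IsCRep f f₀ → IsCRep g g₀ →
    ∑' (j : Fin n) (z : Fin d → ℤ),
      f₀ (mApp (A j) (zv z) + β j) * (starRingEnd ℂ) (g₀ (mApp (B j) (zv z) + γ j)) = 0

/-- Single-lattice orthogonality of `{A z + β}` and `{B z + γ}` on bands `E`, `F'`. -/
def Orth1 {d : ℕ} (F : L2 d ≃ₗᵢ[ℂ] L2 d) (E F' : Set (Rd d))
    (A : Matrix (Fin d) (Fin d) ℝ) (β : Rd d)
    (B : Matrix (Fin d) (Fin d) ℝ) (γ : Rd d) : Prop :=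
  ∀ f ∈ Vband F E, ∀ g ∈ Vband F F', ∀ f₀ g₀, IsCRep f f₀ → IsCRep g g₀ →
    ∑' z : Fin d → ℤ,
      f₀ (mApp A (zv z) + β) * (starRingEnd ℂ) (g₀ (mApp B (zv z) + γ)) = 0

/-- Membership in `Λ = ∪_p C_p^{*-1} ℤ^d`. -/
def memLambda {d : ℕ} {P : Type*} (C : P → Matrix (Fin d) (Fin d) ℝ) (α : Rd d) : Prop :=
  ∃ (p : P) (z : Fin d → ℤ), α = mApp ((C p)ᵀ)⁻¹ (zv z)

/-- Membership in `P_α = {p : C_p^* α ∈ ℤ^d}`. -/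
def memPalpha {d : ℕ} {P : Type*} (C : P → Matrix (Fin d) (Fin d) ℝ) (α : Rd d) (p : P) :
    Prop :=
  ∃ z : Fin d → ℤ, mApp (C p)ᵀ α = zv z

/-- The system `{T_{C_p k} g_p}` is Bessel. -/
def Bessel {d : ℕ} {P : Type*} (C : P → Matrix (Fin d) (Fin d) ℝ) (g : P → L2 d) : Prop :=
  ∃ M : ℝ≥0∞, M < ⊤ ∧ ∀ f : L2 d,
    ∑' (p : P) (k : Fin d → ℤ), (‖pair f (g p) (mApp (C p) (zv k))‖₊ : ℝ≥0∞) ^ 2 ≤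
      M * (‖f‖₊ : ℝ≥0∞) ^ 2

/-- Membership in `D = {f ∈ L² : f̂ ∈ L^∞ with compact support}`. -/
def MemD {d : ℕ} (F : L2 d ≃ₗᵢ[ℂ] L2 d) (f : L2 d) : Prop :=
  (∃ C : ℝ, ∀ᵐ ξ ∂(volume : Measure (Rd d)), ‖(F f : Rd d → ℂ) ξ‖ ≤ C) ∧
  (∃ R : ℝ, ∀ᵐ ξ ∂(volume : Measure (Rd d)), (F f : Rd d → ℂ) ξ ≠ 0 → ‖ξ‖ ≤ R)

/-- The local boundedness condition for the system `{T_{C_p k} g_p}`. -/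
def LocBound {d : ℕ} {P : Type*} (F : L2 d ≃ₗᵢ[ℂ] L2 d)
    (C : P → Matrix (Fin d) (Fin d) ℝ) (g : P → L2 d) : Prop :=
  ∀ f : L2 d, MemD F f →
    ∑' (p : P) (k : Fin d → ℤ),
      ∫⁻ ξ in {ξ : Rd d | (F f : Rd d → ℂ) ξ ≠ 0},
        (‖(F f : Rd d → ℂ) (ξ + mApp ((C p)ᵀ)⁻¹ (zv k))‖₊ : ℝ≥0∞) ^ 2 *
          ENNReal.ofReal |(C p).det|⁻¹ * (‖(F (g p) : Rd d → ℂ) ξ‖₊ : ℝ≥0∞) ^ 2 < ⊤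

/-- `T` is the family of translation operators on `L²`: `T_y f (x) = f (x - y)`. -/
def IsTrans {d : ℕ} (T : Rd d → L2 d → L2 d) : Prop :=
  ∀ (y : Rd d) (f : L2 d),
    (T y f : Rd d → ℂ) =ᵐ[volume] fun x => (f : Rd d → ℂ) (x - y)

/-- `Ω` is the operator `f ↦ Σ_p Σ_k ⟨f, T_{C_p k} g_p⟩ T_{D_p k} h_p`
(the series converging unconditionally in `L²`). -/
def IsOmega {d : ℕ} {P : Type*} (T : Rd d → L2 d → L2 d)
    (C D : P → Matrix (Fin d) (Fin d) ℝ) (g h : P → L2 d) (Ω : L2 d → L2 d) : Prop :=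
  ∀ f : L2 d,
    HasSum (fun pk : P × (Fin d → ℤ) =>
      pair f (g pk.1) (mApp (C pk.1) (zv pk.2)) • T (mApp (D pk.1) (zv pk.2)) (h pk.1)) (Ω f)

/-- The sum `Σ_{p ∈ P_α} |det C_p|⁻¹ conj(ĝ_p(ξ)) ĥ_p(ξ + α)`. -/
def alphaSum {d : ℕ} {P : Type*} (F : L2 d ≃ₗᵢ[ℂ] L2 d)
    (C : P → Matrix (Fin d) (Fin d) ℝ) (g h : P → L2 d) (α ξ : Rd d) : ℂ :=
  ∑' p : {p : P // memPalpha C α p},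
    ((|(C p.1).det|⁻¹ : ℝ) : ℂ) * (starRingEnd ℂ) ((F (g p.1) : Rd d → ℂ) ξ) *
      (F (h p.1) : Rd d → ℂ) (ξ + α)

/-- The unit cube `[0,1]^d`. -/
def cube (d : ℕ) : Set (Rd d) := {x | ∀ i, x i ∈ Set.Icc (0 : ℝ) 1}

/-- The `C` bracket product `[f,g]_C(ξ) = Σ_m f(ξ + Cm) conj(g(ξ + Cm))`. -/
def bracket {d : ℕ} (C : Matrix (Fin d) (Fin d) ℝ) (f g : Rd d → ℂ) (ξ : Rd d) : ℂ :=
  ∑' m : Fin d → ℤ, f (ξ + mApp C (zv m)) * (starRingEnd ℂ) (g (ξ + mApp C (zv m)))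

section

open scoped InnerProductSpace ComplexConjugate

/-- The character `ξ ↦ e^{2πi y·ξ}`. -/
def expInner {d : ℕ} (y ξ : Rd d) : ℂ := Complex.exp ((2 * Real.pi * ⟪y, ξ⟫_ℝ : ℝ) * I)

@[simp]
lemma norm_expInner {d : ℕ} (y ξ : Rd d) : ‖expInner y ξ‖ = 1 :=
  Complex.norm_exp_ofReal_mul_I _

@[fun_prop]
lemma continuous_expInner {d : ℕ} (y : Rd d) : Continuous (expInner y) := by
  unfold expInner
  fun_prop

lemma mApp_def {d : ℕ} (A : Matrix (Fin d) (Fin d) ℝ) (x : Rd d) :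
    mApp A x = WithLp.toLp 2 (A *ᵥ x.ofLp) := rfl

lemma mApp_eq_toLin {d : ℕ} (A : Matrix (Fin d) (Fin d) ℝ) :
    mApp A = ⇑(Matrix.toLin (EuclideanSpace.basisFun (Fin d) ℝ).toBasis
      (EuclideanSpace.basisFun (Fin d) ℝ).toBasis A) := by
  ext x i
  simp [mApp_def, Matrix.toLin_apply, Pi.single_apply]
  rfl

lemma mApp_add {d : ℕ} (A : Matrix (Fin d) (Fin d) ℝ) (x y : Rd d) :
    mApp A (x + y) = mApp A x + mApp A y := by
  simp [mApp_eq_toLin]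

lemma continuous_mApp {d : ℕ} (A : Matrix (Fin d) (Fin d) ℝ) : Continuous (mApp A) := by
  rw [mApp_eq_toLin]
  exact LinearMap.continuous_of_finiteDimensional _

lemma map_mApp_volume {d : ℕ} {A : Matrix (Fin d) (Fin d) ℝ} (hA : A.det ≠ 0) :
    (volume : Measure (Rd d)).map (mApp A) = ENNReal.ofReal |A.det⁻¹| • volume := by
  rw [mApp_eq_toLin]
  have := Measure.map_linearMap_addHaar_eq_smul_addHaar (volume : Measure (Rd d))
    (f := Matrix.toLin (EuclideanSpace.basisFun (Fin d) ℝ).toBasis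
      (EuclideanSpace.basisFun (Fin d) ℝ).toBasis A) (by simpa using hA)
  simpa using this

lemma mApp_mApp {d : ℕ} (A B : Matrix (Fin d) (Fin d) ℝ) (x : Rd d) :
    mApp A (mApp B x) = mApp (A * B) x := by
  ext i
  simp [mApp_def]

lemma mApp_one {d : ℕ} (x : Rd d) : mApp 1 x = x := by
  simp [mApp]

lemma inner_mApp {d : ℕ} (A : Matrix (Fin d) (Fin d) ℝ) (x y : Rd d) :
    ⟪mApp A x, y⟫_ℝ = ⟪x, mApp Aᵀ y⟫_ℝ := by
  simp [mApp_def, EuclideanSpace.inner_eq_star_dotProduct, Matrix.mulVec_transpose,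
    Matrix.dotProduct_mulVec, dotProduct_comm]

lemma integrable_comp_mApp {d : ℕ} {A : Matrix (Fin d) (Fin d) ℝ} (hA : A.det ≠ 0)
    {u : Rd d → ℂ} (hu : Integrable u) : Integrable fun x => u (mApp A x) := by
  refine Integrable.comp_measurable (g := u) ?_ (continuous_mApp A).measurable
  rw [map_mApp_volume hA]
  exact hu.smul_measure ENNReal.ofReal_ne_top

lemma integral_comp_mApp {d : ℕ} {A : Matrix (Fin d) (Fin d) ℝ} (hA : A.det ≠ 0)
    {u : Rd d → ℂ} (hu : AEStronglyMeasurable u) :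
    ∫ x, u (mApp A x) = |A.det|⁻¹ * ∫ x, u x := by
  rw [← integral_map (φ := mApp A) (f := u) (continuous_mApp A).measurable.aemeasurable
    (by rw [map_mApp_volume hA]; exact hu.smul_measure _), map_mApp_volume hA, integral_smul_measure]
  simp [abs_inv]

lemma quasiMeasurePreserving_mApp {d : ℕ} {A : Matrix (Fin d) (Fin d) ℝ} (hA : A.det ≠ 0) :
    Measure.QuasiMeasurePreserving (mApp A) (volume : Measure (Rd d)) volume := by
  refine ⟨(continuous_mApp A).measurable, ?_⟩
  rw [map_mApp_volume hA]
  exact Measure.smul_absolutelyContinuous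

lemma memLp_comp_mApp {d : ℕ} {A : Matrix (Fin d) (Fin d) ℝ} (hA : A.det ≠ 0)
    {u : Rd d → ℂ} (hu : MemLp u 2) : MemLp (fun x => u (mApp A x)) 2 := by
  refine MemLp.comp_of_map (g := u) ?_ (continuous_mApp A).measurable.aemeasurable
  rw [map_mApp_volume hA]
  exact hu.smul_measure ENNReal.ofReal_ne_top

/-- The Fourier side of `pair`. -/
lemma pair_eq_integral_fourier {d : ℕ} (F : L2 d ≃ₗᵢ[ℂ] L2 d) (hF : IsFourier F)
    (f g : L2 d) (y : Rd d) :
    pair f g y = ∫ ξ, (F f : Rd d → ℂ) ξ * conj ((F g : Rd d → ℂ) ξ) *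
      expInner y ξ := by
  have hmp : MeasurePreserving (fun x : Rd d => x - y) volume volume :=
    measurePreserving_sub_right volume y
  let τ : L2 d →ₗᵢ[ℂ] L2 d := Lp.compMeasurePreservingₗᵢ ℂ (fun x : Rd d => x - y) hmp
  have hτ (g : L2 d) : (τ g : Rd d → ℂ) =ᵐ[volume] fun x => (g : Rd d → ℂ) (x - y) :=
    Lp.coeFn_compMeasurePreserving g hmp
  have hchar : Continuous fun ξ : Rd d => expInner y ξ := by fun_prop
  have hM : MemLp (fun ξ => (F f : Rd d → ℂ) ξ * expInner y ξ) 2 :=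
    (Lp.memLp (F f)).of_le
      ((Lp.aestronglyMeasurable _).mul hchar.aestronglyMeasurable) (.of_forall fun ξ => by simp)
  have hpair (g : L2 d) : pair f g y = ⟪τ g, f⟫_ℂ := by
    rw [L2.inner_def]
    refine integral_congr_ae ?_
    filter_upwards [hτ g] with x hx
    simp [hx]
  have hrhs (g : L2 d) : ∫ ξ, (F f : Rd d → ℂ) ξ * conj ((F g : Rd d → ℂ) ξ) *
      expInner y ξ = ⟪F g, hM.toLp⟫_ℂ := by
    rw [L2.inner_def]
    refine integral_congr_ae ?_
    filter_upwards [hM.coeFn_toLp] with x hx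
    simp only [hx, RCLike.inner_apply]
    ring
  rw [hpair, hrhs]
  refine Lp.induction (p := 2) ENNReal.ofNat_ne_top
    (motive := fun g => ⟪τ g, f⟫_ℂ = ⟪F g, hM.toLp⟫_ℂ) ?_ ?_ ?_ g
  · intro c s hs hμs
    set g : L2 d := ((Lp.simpleFunc.indicatorConst 2 hs hμs.ne c : Lp.simpleFunc ℂ 2 _) : L2 d)
    have hgi : Integrable (g : Rd d → ℂ) := by
      have h : (g : Rd d → ℂ) =ᵐ[volume] s.indicator fun _ => c := by
        simp only [g, Lp.simpleFunc.coe_indicatorConst]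
        exact indicatorConstLp_coeFn
      exact (integrable_congr h).2 ((integrable_indicator_iff hs).2 (integrableOn_const hμs.ne))
    have hτi : Integrable (τ g : Rd d → ℂ) :=
      (integrable_congr (hτ g)).2 (hgi.comp_sub_right y)
    rw [← F.inner_map_map, ← hrhs, L2.inner_def]
    refine integral_congr_ae ?_
    filter_upwards [hF g hgi, hF (τ g) hτi] with ξ h1 h2
    have h3 : 𝓕 (τ g : Rd d → ℂ) ξ = conj (expInner y ξ) * 𝓕 (g : Rd d → ℂ) ξ := by
      rw [Real.fourier_eq, Real.fourier_eq, integral_congr_ae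
        (g := fun v => Real.fourierChar (-⟪v, ξ⟫_ℝ) • (g : Rd d → ℂ) (v - y))
        ((hτ g).mono fun v hv => by simp only [hv]),
        ← integral_add_right_eq_self _ y, ← integral_const_mul]
      congr 1 with v
      rw [add_sub_cancel_right, inner_add_left, Circle.smul_def, Circle.smul_def, smul_eq_mul,
        smul_eq_mul, Real.fourierChar_apply, Real.fourierChar_apply, expInner, ← Complex.exp_conj,
        ← mul_assoc, ← Complex.exp_add]
      congr 2
      simp only [map_mul, conj_I, conj_ofReal]
      push_cast
      ring
    simp only [RCLike.inner_apply, h1, h2, h3, map_mul, Complex.conj_conj]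
    ring
  · intro _ _ hf hg _ h1 h2
    simp only [map_add, inner_add_left, h1, h2]
  · exact isClosed_eq (by fun_prop) (by fun_prop)

/-- The half-open unit cube with lower corner `m ∈ ℤ^d`. -/
def latticeCell {d : ℕ} (m : Fin d → ℤ) : Set (Rd d) :=
  {x | ∀ i, x i ∈ Set.Ioc (m i : ℝ) (m i + 1)}

lemma measurableSet_latticeCell {d : ℕ} (m : Fin d → ℤ) : MeasurableSet (latticeCell m) := by
  simp only [latticeCell, Set.ofPred_forall]
  exact MeasurableSet.iInter fun i =>
    measurableSet_Ioc.preimage (EuclideanSpace.proj (𝕜 := ℝ) i).continuous.measurable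

lemma restrict_latticeCell_zero (d : ℕ) :
    (volume : Measure (Rd d)).restrict (latticeCell 0) = volume.restrict (cube d) := by
  refine Measure.restrict_congr_set ?_
  have h := (PiLp.volume_preserving_ofLp (Fin d)).quasiMeasurePreserving.ae_eq
    (Measure.univ_pi_Ioc_ae_eq_Icc (μ := fun _ : Fin d => (volume : Measure ℝ)) (f := 0) (g := 1))
  have e1 : (latticeCell 0 : Set (Rd d)) =
      WithLp.ofLp ⁻¹' (Set.univ.pi fun i : Fin d => Set.Ioc ((0 : Fin d → ℝ) i) 1) := by
    ext x
    simp [latticeCell]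
  have e2 : cube d = WithLp.ofLp ⁻¹' (Set.Icc (0 : Fin d → ℝ) 1) := by
    ext x
    simp [cube, Pi.le_def, forall_and]
  rw [e1, e2]
  exact h

/-- The torus `(ℝ/ℤ)^d` is measure-isomorphic to the unit cube. -/
lemma measurePreserving_torus_cube (d : ℕ) :
    MeasurePreserving (fun x : UnitAddTorus (Fin d) =>
      (WithLp.toLp 2 (fun i => (AddCircle.equivIoc (1:ℝ) 0 (x i) : ℝ)) : Rd d))
      (Measure.pi fun _ => AddCircle.haarAddCircle) (volume.restrict (cube d)) := by
  rw [← restrict_latticeCell_zero]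
  have h1 := UnitAddTorus.measurePreserving_equivPiIoc (d := Fin d) (0 : Fin d → ℝ)
  have hs : MeasurableSet {x : Fin d → ℝ | ∀ i, x i ∈ Set.Ioc ((0 : Fin d → ℝ) i)
      ((0 : Fin d → ℝ) i + 1)} := MeasurableSet.univ_pi' fun i => measurableSet_Ioc
  have h2 : MeasurePreserving (Subtype.val : {x : Fin d → ℝ // ∀ i, x i ∈ Set.Ioc
      ((0 : Fin d → ℝ) i) ((0 : Fin d → ℝ) i + 1)} → (Fin d → ℝ))
      (Measure.comap Subtype.val volume) (volume.restrict
        {x : Fin d → ℝ | ∀ i, x i ∈ Set.Ioc ((0 : Fin d → ℝ) i) ((0 : Fin d → ℝ) i + 1)}) :=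
    ⟨measurable_subtype_coe, map_comap_subtype_coe hs _⟩
  have h3 := (PiLp.volume_preserving_toLp (Fin d)).restrict_preimage (measurableSet_latticeCell 0)
  have h4 : (WithLp.toLp 2 ⁻¹' latticeCell 0 : Set (Fin d → ℝ)) =
      {x : Fin d → ℝ | ∀ i, x i ∈ Set.Ioc ((0 : Fin d → ℝ) i) ((0 : Fin d → ℝ) i + 1)} := by
    ext x
    simp [latticeCell]
  rw [h4] at h3
  exact (h3.comp h2).comp h1

lemma integral_eq_integral_cube_sum {d : ℕ} {u : Rd d → ℂ} (hu : Integrable u)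
    (S : Finset (Fin d → ℤ))
    (hS : ∀ m ∉ S, ∀ᵐ η ∂(volume.restrict (cube d)), u (η + zv m) = 0) :
    ∫ x, u x = ∫ η in cube d, ∑ m ∈ S, u (η + zv m) := by
  have hcover : ⋃ m : Fin d → ℤ, latticeCell m = Set.univ := by
    refine Set.eq_univ_of_forall fun x => Set.mem_iUnion.2 ⟨fun i => ⌈x i⌉ - 1, fun i => ?_⟩
    have := Int.ceil_lt_add_one (x i)
    have := Int.le_ceil (x i)
    push_cast
    constructor <;> linarith
  have hdisj : Pairwise (Function.onFun Disjoint (latticeCell (d := d))) := by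
    intro m n hmn
    refine Set.disjoint_left.2 fun x hm hn => hmn (funext fun i => ?_)
    have h1 := hm i
    have h2 := hn i
    have e1 : ⌈x i⌉ = m i + 1 :=
      Int.ceil_eq_iff.2 (by push_cast; constructor <;> linarith [h1.1, h1.2])
    have e2 : ⌈x i⌉ = n i + 1 :=
      Int.ceil_eq_iff.2 (by push_cast; constructor <;> linarith [h2.1, h2.2])
    linarith
  have hcell (m : Fin d → ℤ) : ∫ x in latticeCell m, u x = ∫ η in cube d, u (η + zv m) := by
    rw [← restrict_latticeCell_zero,
      ← (measurePreserving_add_right volume (zv m)).setIntegral_preimage_emb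
      (measurableEmbedding_addRight (zv m))]
    congr 2
    ext x
    simp [latticeCell, zv]
    exact forall_congr' fun i => and_congr_right fun _ =>
      ⟨fun _ => by linarith, fun _ => by linarith⟩
  have h := hasSum_integral_iUnion (fun m : Fin d → ℤ => measurableSet_latticeCell m) hdisj
    (f := u) (μ := volume) hu.integrableOn
  rw [hcover, Measure.restrict_univ] at h
  simp only [hcell] at h
  rw [integral_finsetSum _ fun m _ => (hu.comp_add_right (zv m)).integrableOn]
  exact h.unique (hasSum_sum_of_ne_finset_zero fun m hm => by
    rw [integral_congr_ae (hS m hm)]; simp)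

local instance : MeasureSpace UnitAddCircle := ⟨AddCircle.haarAddCircle⟩

/-- Parseval's identity on the unit cube. -/
lemma hasSum_fourierCoeff_cube {d : ℕ} {Φ Ψ : Rd d → ℂ}
    (hΦ : MemLp Φ 2 (volume.restrict (cube d))) (hΨ : MemLp Ψ 2 (volume.restrict (cube d))) :
    HasSum (fun k : Fin d → ℤ =>
      (∫ η in cube d, Φ η * expInner (zv k) η) *
        conj (∫ η in cube d, Ψ η * expInner (zv k) η))
      (∫ η in cube d, Φ η * conj (Ψ η)) := by
  set s : UnitAddTorus (Fin d) → Rd d := fun x =>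
      (WithLp.toLp 2 (fun i => (AddCircle.equivIoc (1:ℝ) 0 (x i) : ℝ)) : Rd d)
  have hs : MeasurePreserving s volume (volume.restrict (cube d)) := measurePreserving_torus_cube d
  have hint (w : Rd d → ℂ) (hw : AEStronglyMeasurable w (volume.restrict (cube d))) :
      ∫ η in cube d, w η = ∫ x, w (s x) := by
    rw [← hs.map_eq] at hw ⊢
    exact integral_map hs.aemeasurable hw
  have hmF (k : Fin d → ℤ) (x : UnitAddTorus (Fin d)) :
      UnitAddTorus.mFourier k x = expInner (zv k) (s x) := by
    have hx (i : Fin d) : (fourier (k i) (x i) : ℂ) =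
        Complex.exp (2 * Real.pi * I * k i * (AddCircle.equivIoc (1 : ℝ) 0 (x i) : ℝ)) := by
      conv_lhs => rw [← AddCircle.coe_equivIoc (p := (1 : ℝ)) (a := 0) (y := x i), fourier_coe_apply]
      simp
    simp only [UnitAddTorus.mFourier, ContinuousMap.coe_mk, hx, expInner, ← Complex.exp_sum]
    congr 1
    simp [s, zv, PiLp.inner_apply, Finset.mul_sum, Finset.sum_mul]
    refine Finset.sum_congr rfl fun i _ => ?_
    ring
  have hcoeff {w : Rd d → ℂ} (hw : MemLp w 2 (volume.restrict (cube d))) (k : Fin d → ℤ) :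
      ∫ η in cube d, w η * expInner (zv k) η =
        UnitAddTorus.mFourierCoeff (hw.comp_measurePreserving hs).toLp (-k) := by
    rw [hint (fun η => w η * expInner (zv k) η)
      (hw.1.mul (continuous_expInner (zv k)).aestronglyMeasurable)]
    refine integral_congr_ae ?_
    filter_upwards [(hw.comp_measurePreserving hs).coeFn_toLp] with x hx
    simp [hx, hmF, mul_comm]
  have h := UnitAddTorus.hasSum_prod_mFourierCoeff (hΨ.comp_measurePreserving hs).toLp
    (hΦ.comp_measurePreserving hs).toLp
  rw [← (Equiv.neg (Fin d → ℤ)).hasSum_iff] at h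
  convert! h using 1
  · ext k
    rw [hcoeff hΦ, hcoeff hΨ, mul_comm]
    rfl
  · rw [hint (fun η => Φ η * conj (Ψ η))
      (hΦ.1.mul (Complex.continuous_conj.comp_aestronglyMeasurable hΨ.1))]
    refine integral_congr_ae ?_
    filter_upwards [(hΦ.comp_measurePreserving hs).coeFn_toLp,
      (hΨ.comp_measurePreserving hs).coeFn_toLp] with x h1 h2
    simp [h1, h2, mul_comm]

lemma conj_bracket {d : ℕ} (A : Matrix (Fin d) (Fin d) ℝ) (a b : Rd d → ℂ) (ξ : Rd d) :
    conj (bracket A a b ξ) = bracket A b a ξ := by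
  simp [bracket, Complex.conj_tsum, mul_comm]

lemma exists_norm_mApp_le {d : ℕ} (A : Matrix (Fin d) (Fin d) ℝ) :
    ∃ K : ℝ, 0 ≤ K ∧ ∀ x, ‖mApp A x‖ ≤ K * ‖x‖ := by
  rw [mApp_eq_toLin]
  exact ⟨_, norm_nonneg _, (LinearMap.toContinuousLinearMap (Matrix.toLin
    (EuclideanSpace.basisFun (Fin d) ℝ).toBasis
    (EuclideanSpace.basisFun (Fin d) ℝ).toBasis A)).le_opNorm⟩

lemma expInner_add_zv {d : ℕ} (k m : Fin d → ℤ) (η : Rd d) :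
    expInner (zv k) (η + zv m) = expInner (zv k) η := by
  have h : ⟪(zv k : Rd d), zv m⟫_ℝ = ((∑ i, k i * m i : ℤ) : ℝ) := by
    simp [zv, PiLp.inner_apply, mul_comm]
  simp only [expInner, inner_add_right, h]
  rw [← mul_one (Complex.exp (((2 * Real.pi * ⟪(zv k : Rd d), η⟫_ℝ : ℝ) : ℂ) * I)),
    ← Complex.exp_int_mul_two_pi_mul_I (∑ i, k i * m i), ← Complex.exp_add]
  congr 1
  push_cast
  ring

/-- Only finitely many lattice translates of a compactly supported function meet the cube. -/
lemma exists_finset_ae_eq_zero {d : ℕ} {A : Matrix (Fin d) (Fin d) ℝ} (hA : A.det ≠ 0)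
    {a : Rd d → ℂ} {R : ℝ} (ha : ∀ᵐ ξ ∂(volume : Measure (Rd d)), a ξ ≠ 0 → ‖ξ‖ ≤ R) :
    ∃ S : Finset (Fin d → ℤ), ∀ᵐ η ∂(volume.restrict (cube d)), ∀ m ∉ S,
      a (mApp A (η + zv m)) = 0 := by
  obtain ⟨K, hK, hKA⟩ := exists_norm_mApp_le A⁻¹
  obtain ⟨N, hN⟩ := exists_nat_ge (K * R + 1)
  refine ⟨Fintype.piFinset fun _ => Finset.Icc (-(N : ℤ)) N, ?_⟩
  have hcube : MeasurableSet (cube d) := by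
    simp only [cube, Set.ofPred_forall]
    exact MeasurableSet.iInter fun i =>
      measurableSet_Icc.preimage (EuclideanSpace.proj (𝕜 := ℝ) i).continuous.measurable
  refine ae_all_iff.2 fun m => ?_
  have h := ((quasiMeasurePreserving_mApp hA).comp
    (measurePreserving_add_right volume (zv m)).quasiMeasurePreserving).ae ha
  filter_upwards [ae_restrict_of_ae h, ae_restrict_mem hcube] with η hη hc hm
  by_contra hne
  refine hm (Fintype.mem_piFinset.2 fun i => ?_)
  have h1 : ‖η + zv m‖ ≤ K * R := by
    have h2 := hKA (mApp A (η + zv m))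
    rw [mApp_mApp, Matrix.nonsing_inv_mul _ (isUnit_iff_ne_zero.2 hA), mApp_one] at h2
    exact h2.trans (mul_le_mul_of_nonneg_left (hη hne) hK)
  have h2 : |η i + m i| ≤ K * R := by
    have := (PiLp.norm_apply_le (η + zv m) i).trans h1
    simpa [zv] using this
  have h3 := hc i
  have h4 := abs_le.1 h2
  rw [Finset.mem_Icc]
  constructor
  · have : (-(N : ℝ)) ≤ m i := by linarith [h3.1, h3.2]
    exact_mod_cast this
  · have : (m i : ℝ) ≤ N := by linarith [h3.1, h3.2]
    exact_mod_cast this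

lemma memLp_mul_conj {d : ℕ} {a b : Rd d → ℂ} (ha : AEStronglyMeasurable a) (hb : MemLp b 2)
    {K : ℝ} (haK : ∀ᵐ ξ ∂(volume : Measure (Rd d)), ‖a ξ‖ ≤ K) :
    MemLp (fun ξ => a ξ * conj (b ξ)) 2 := by
  refine hb.of_le_mul (c := K)
    (ha.mul (Complex.continuous_conj.comp_aestronglyMeasurable hb.1)) ?_
  filter_upwards [haK] with ξ h
  simpa using mul_le_mul_of_nonneg_right h (norm_nonneg (b ξ))

lemma bracket_ae_eq_sum {d : ℕ} {A : Matrix (Fin d) (Fin d) ℝ} {a : Rd d → ℂ} (b : Rd d → ℂ)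
    {S : Finset (Fin d → ℤ)}
    (hS : ∀ᵐ η ∂(volume.restrict (cube d)), ∀ m ∉ S, a (mApp A (η + zv m)) = 0) :
    (fun η => bracket A a b (mApp A η)) =ᵐ[volume.restrict (cube d)]
      fun η => ∑ m ∈ S, a (mApp A (η + zv m)) * conj (b (mApp A (η + zv m))) := by
  filter_upwards [hS] with η hη
  simp only [bracket, ← mApp_add]
  exact tsum_eq_sum fun m hm => by rw [hη m hm, zero_mul]

lemma memLp_bracket {d : ℕ} {A : Matrix (Fin d) (Fin d) ℝ} (hA : A.det ≠ 0) {a b : Rd d → ℂ}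
    (ha : AEStronglyMeasurable a) (hb : MemLp b 2)
    {K : ℝ} (haK : ∀ᵐ ξ ∂(volume : Measure (Rd d)), ‖a ξ‖ ≤ K)
    {R : ℝ} (haR : ∀ᵐ ξ ∂(volume : Measure (Rd d)), a ξ ≠ 0 → ‖ξ‖ ≤ R) :
    MemLp (fun η => bracket A a b (mApp A η)) 2 (volume.restrict (cube d)) := by
  obtain ⟨S, hS⟩ := exists_finset_ae_eq_zero hA haR
  rw [memLp_congr_ae (bracket_ae_eq_sum b hS)]
  exact memLp_finsetSum S fun m _ =>
    ((memLp_comp_mApp hA (memLp_mul_conj ha hb haK)).comp_measurePreserving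
      (measurePreserving_add_right volume (zv m))).restrict _

/-- Periodization: the Fourier coefficients of the bracket product. -/
lemma integral_mul_conj_expInner {d : ℕ} {C : Matrix (Fin d) (Fin d) ℝ} (hC : C.det ≠ 0)
    {a b : Rd d → ℂ} (ha : MemLp a 2) (hb : MemLp b 2)
    {R : ℝ} (haR : ∀ᵐ ξ ∂(volume : Measure (Rd d)), a ξ ≠ 0 → ‖ξ‖ ≤ R) (k : Fin d → ℤ) :
    ∫ ξ, a ξ * conj (b ξ) * expInner (mApp C (zv k)) ξ =
      ((|C.det|⁻¹ : ℝ) : ℂ) *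
        ∫ η in cube d, bracket Cᵀ⁻¹ a b (mApp Cᵀ⁻¹ η) * expInner (zv k) η := by
  have hdet : Cᵀ⁻¹.det = C.det⁻¹ := by simp [Matrix.det_nonsing_inv]
  have hA : Cᵀ⁻¹.det ≠ 0 := by rw [hdet]; exact inv_ne_zero hC
  have hexp (η : Rd d) : expInner (mApp C (zv k)) (mApp Cᵀ⁻¹ η) = expInner (zv k) η := by
    have : IsUnit Cᵀ.det := by simpa using hC
    simp only [expInner]
    rw [inner_mApp, mApp_mApp, Matrix.mul_nonsing_inv _ this, mApp_one]
  have hint : Integrable fun ξ => a ξ * conj (b ξ) * expInner (mApp C (zv k)) ξ := by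
    have h1 : Integrable fun ξ => a ξ * conj (b ξ) := ha.integrable_mul hb.star
    refine h1.mono (h1.1.mul (continuous_expInner _).aestronglyMeasurable) (.of_forall fun ξ => ?_)
    simp
  obtain ⟨S, hS⟩ := exists_finset_ae_eq_zero hA haR
  have hcov := integral_comp_mApp hA hint.1
  have hint' := integrable_comp_mApp hA hint
  simp only [hexp] at hcov hint'
  rw [integral_eq_integral_cube_sum hint' S fun m hm => ?_] at hcov
  · have : ∫ η in cube d, bracket Cᵀ⁻¹ a b (mApp Cᵀ⁻¹ η) * expInner (zv k) η =
        ∫ η in cube d, ∑ m ∈ S, a (mApp Cᵀ⁻¹ (η + zv m)) * conj (b (mApp Cᵀ⁻¹ (η + zv m))) *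
          expInner (zv k) (η + zv m) := by
      refine integral_congr_ae ?_
      filter_upwards [bracket_ae_eq_sum b hS] with η hη
      simp only [hη, Finset.sum_mul, expInner_add_zv]
    rw [this, hcov, hdet, abs_inv, inv_inv, ← mul_assoc, ← Complex.ofReal_mul,
      inv_mul_cancel₀ (abs_ne_zero.2 hC), Complex.ofReal_one, one_mul]
  · filter_upwards [hS] with η hη
    rw [hη m hm, zero_mul, zero_mul]

lemma inner_trans_eq_conj_pair {d : ℕ} {T : Rd d → L2 d → L2 d} (hT : IsTrans T)
    (g h : L2 d) (y : Rd d) : ⟪g, T y h⟫_ℂ = conj (pair g h y) := by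
  rw [L2.inner_def, pair, ← integral_conj]
  refine integral_congr_ae ?_
  filter_upwards [hT y h] with x hx
  simp [hx, mul_comm]

lemma hasSum_pair_mul_conj_pair {d : ℕ} {F : L2 d ≃ₗᵢ[ℂ] L2 d} (hF : IsFourier F)
    {C D : Matrix (Fin d) (Fin d) ℝ} (hC : C.det ≠ 0) (hD : D.det ≠ 0) {f g' : L2 d}
    (hf : MemD F f) (hg' : MemD F g') (g h : L2 d) :
    HasSum (fun k : Fin d → ℤ =>
        pair f g (mApp C (zv k)) * conj (pair g' h (mApp D (zv k))))
      (((|C.det * D.det|⁻¹ : ℝ) : ℂ) *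
        ∫ ξ in cube d, bracket Cᵀ⁻¹ (F f : Rd d → ℂ) (F g : Rd d → ℂ) (mApp Cᵀ⁻¹ ξ) *
          bracket Dᵀ⁻¹ (F h : Rd d → ℂ) (F g' : Rd d → ℂ) (mApp Dᵀ⁻¹ ξ)) := by
  obtain ⟨⟨K, hK⟩, R, hR⟩ := hf
  obtain ⟨⟨K', hK'⟩, R', hR'⟩ := hg'
  have hC' : Cᵀ⁻¹.det ≠ 0 := by simpa [Matrix.det_nonsing_inv] using hC
  have hD' : Dᵀ⁻¹.det ≠ 0 := by simpa [Matrix.det_nonsing_inv] using hD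
  have hs := (hasSum_fourierCoeff_cube
    (memLp_bracket hC' (Lp.memLp (F f)).1 (Lp.memLp (F g)) hK hR)
    (memLp_bracket hD' (Lp.memLp (F g')).1 (Lp.memLp (F h)) hK' hR')).mul_left
      (((|C.det * D.det|⁻¹ : ℝ) : ℂ))
  simp only [conj_bracket] at hs
  convert! hs using 2 with k
  rw [pair_eq_integral_fourier F hF, pair_eq_integral_fourier F hF,
    integral_mul_conj_expInner hC (Lp.memLp _) (Lp.memLp _) hR,
    integral_mul_conj_expInner hD (Lp.memLp _) (Lp.memLp _) hR', map_mul, conj_ofReal, abs_mul,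
    mul_inv, ofReal_mul]
  ring

end

/-- Lemma 4 of the paper. With `G = {T_{C_p k} g_p}` and
`H = {T_{D_p k} h_p}` Bessel and locally bounded, and
`Ω f = Σ_p Σ_k ⟨f, T_{C_p k} g_p⟩ T_{D_p k} h_p`, for all `f, g' ∈ D` one has
`⟨Ω f, g'⟩ = Σ_p |det C_p D_p|⁻¹ ∫_{[0,1]^d} [f̂, ĝ_p]_{C_p'}(C_p' ξ) [ĥ_p, ĝ']_{D_p'}(D_p' ξ) dξ`. -/
theorem omega_inner_eq_bracket {d : ℕ} (hd : 1 ≤ d) {P : Type} [Countable P]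
    (F : L2 d ≃ₗᵢ[ℂ] L2 d) (hF : IsFourier F)
    (C D : P → Matrix (Fin d) (Fin d) ℝ)
    (hC : ∀ p, IsUnit (C p).det) (hD : ∀ p, IsUnit (D p).det)
    (g h : P → L2 d)
    (hGb : Bessel C g) (hHb : Bessel D h)
    (hGl : LocBound F C g) (hHl : LocBound F D h)
    (T : Rd d → L2 d → L2 d) (hT : IsTrans T)
    (Ω : L2 d → L2 d) (hΩ : IsOmega T C D g h Ω) :
    ∀ f g' : L2 d, MemD F f → MemD F g' →
      (∫ x, (Ω f : Rd d → ℂ) x * (starRingEnd ℂ) ((g' : Rd d → ℂ) x)) =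
        ∑' p : P, ((|(C p).det * (D p).det|⁻¹ : ℝ) : ℂ) *
          ∫ ξ in cube d,
            bracket ((C p)ᵀ)⁻¹ (F f : Rd d → ℂ) (F (g p) : Rd d → ℂ)
              (mApp ((C p)ᵀ)⁻¹ ξ) *
            bracket ((D p)ᵀ)⁻¹ (F (h p) : Rd d → ℂ) (F g' : Rd d → ℂ)
              (mApp ((D p)ᵀ)⁻¹ ξ) := by
  intro f g' hf hg'
  have h1 : ∫ x, (Ω f : Rd d → ℂ) x * (starRingEnd ℂ) ((g' : Rd d → ℂ) x) = inner ℂ g' (Ω f) := by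
    simp [L2.inner_def]
  have h2 := (hΩ f).mapL (innerSL ℂ g')
  simp only [map_smul, innerSL_apply_apply, inner_trans_eq_conj_pair hT, smul_eq_mul] at h2
  rw [h1]
  exact (h2.prod_fiberwise fun p =>
    hasSum_pair_mul_conj_pair hF (hC p).ne_zero (hD p).ne_zero hf hg' (g p) (h p)).tsum_eq.symm

end GSL
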